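/- Let T₀ ∈ (0,∞) and let f : (0,T₀] → 𝔹 be strongly measurable with f(t) ∈ 𝒟(𝓛) for a.e. t ∈ (0,T₀] and ∫₀^{T₀} (‖f(t)‖ + ‖𝓛f(t)‖) dt < ∞. Then u(t) := ∫₀^t ∫₀^∞ P⁰_r f(s) p̄(r, t−s) dr ds satisfies u(t) ∈ 𝒟(𝓛) for a.e. t ∈ (0,T₀] and ∫₀^{T₀} ‖𝓛u(t)‖ dt < ∞. If moreover there is K < ∞ with ‖f(s)‖ + ‖𝓛f(s)‖ ≤ K for a.e. s ∈ (0,T₀], then t ↦ 𝓛u(t) is continuous from (0,T₀] to 𝔹. -/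

import Mathlib

open MeasureTheory Filter Set
open scoped ENNReal Topology

section Convolution

variable {G E : Type*} [NormedAddCommGroup E] [NormedSpace ℝ E]
  [AddCommGroup G] [TopologicalSpace G] [IsTopologicalAddGroup G] [LocallyCompactSpace G]
  [SecondCountableTopology G] [MeasurableSpace G] [BorelSpace G]

/-- The convolution of an integrable scalar kernel with a bounded function is continuous. -/
theorem continuous_integral_smul_of_integrable_of_bounded {μ : Measure G} [μ.Regular]
    [μ.IsAddLeftInvariant] [μ.IsNegInvariant] {k : G → ℝ} {g : G → E} {C : ℝ}
    (hk : Integrable k μ) (hg : AEStronglyMeasurable g μ) (hC : ∀ᵐ x ∂μ, ‖g x‖ ≤ C) :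
    Continuous fun x => ∫ y, k (x - y) • g y ∂μ := by
  have hshift : ∀ {j : G → ℝ}, Integrable j μ → ∀ x,
      Integrable (fun y => j (x - y) • g y) μ := fun hj x =>
    (hj.comp_sub_left x).smul_bdd C hg hC
  have hloc : LocallyIntegrable g μ :=
    (memLp_top_of_bound hg C hC).locallyIntegrable le_top
  refine continuous_of_uniform_approx_of_continuous fun U hU => ?_
  obtain ⟨ε, hε, hεU⟩ := Metric.mem_uniformity_dist.1 hU
  obtain ⟨j, hjc, hjk, hj, hji⟩ := hk.exists_hasCompactSupport_integral_sub_le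
    (show 0 < ε / 2 / (|C| + 1) by positivity)
  refine ⟨_, hjc.continuous_convolution_left (ContinuousLinearMap.lsmul ℝ ℝ) hj hloc,
    fun x => hεU ?_⟩
  rw [convolution_lsmul_swap, dist_eq_norm, ← integral_sub (hshift hk x) (hshift hji x)]
  simp_rw [← sub_smul]
  calc ‖∫ y, (k (x - y) - j (x - y)) • g y ∂μ‖
      ≤ ∫ y, ‖k (x - y) - j (x - y)‖ * (|C| + 1) ∂μ := by
        refine norm_integral_le_of_norm_le
          (((hk.sub hji).norm.comp_sub_left x).mul_const _) ?_
        filter_upwards [hC] with y hy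
        rw [norm_smul]
        gcongr
        linarith [le_abs_self C]
    _ = (∫ y, ‖k y - j y‖ ∂μ) * (|C| + 1) := by
        rw [integral_mul_const, integral_sub_left_eq_self (fun y => ‖k y - j y‖)]
    _ ≤ ε / 2 / (|C| + 1) * (|C| + 1) := by gcongr
    _ < ε := by
        rw [div_mul_cancel₀ _ (by positivity)]
        linarith

end Convolution

section Kernel

theorem laplaceExponent_one_pos {ν : Measure ℝ}
    (hν_loc : ∫⁻ x in Ioi (0:ℝ), ENNReal.ofReal (min 1 x) ∂ν ≠ ⊤)
    (hν : ν (Ioi (0:ℝ)) ≠ 0) :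
    0 < ∫ x in Ioi (0:ℝ), (1 - Real.exp (-1 * x)) ∂ν := by
  have hnn : ∀ x ∈ Ioi (0:ℝ), 0 < 1 - Real.exp (-1 * x) := fun x hx => by
    have : Real.exp (-1 * x) < 1 := Real.exp_lt_one_iff.2 (by simpa using hx)
    linarith
  have hint : IntegrableOn (fun x => 1 - Real.exp (-1 * x)) (Ioi (0:ℝ)) ν := by
    refine ⟨by fun_prop, ?_⟩
    rw [hasFiniteIntegral_iff_ofReal
      ((ae_restrict_iff' measurableSet_Ioi).2 (ae_of_all _ fun x hx => (hnn x hx).le))]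
    refine lt_of_le_of_lt (setLIntegral_mono' measurableSet_Ioi fun x hx => ?_) hν_loc.lt_top
    refine ENNReal.ofReal_le_ofReal (le_min ?_ ?_)
    · linarith [Real.exp_pos (-1 * x)]
    · linarith [Real.add_one_le_exp (-1 * x)]
  rw [setIntegral_pos_iff_support_of_nonneg_ae
    ((ae_restrict_iff' measurableSet_Ioi).2 (ae_of_all _ fun x hx => (hnn x hx).le)) hint]
  refine lt_of_lt_of_le (pos_iff_ne_zero.2 hν) (measure_mono fun x hx => ⟨(hnn x hx).ne', hx⟩)

/-- Chernoff bound for the lower tail, in terms of the Laplace transform at `1`. -/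
theorem measure_Ioc_le_of_laplace {μ : Measure ℝ} [IsFiniteMeasure μ] {c : ℝ} (hc : 0 < c)
    (hμ : ∫ s, Real.exp (-1 * s) ∂μ = c) (T : ℝ) :
    μ (Ioc 0 T) ≤ ENNReal.ofReal (Real.exp T * c) := by
  have hint : Integrable (fun s => Real.exp (-1 * s)) μ := by
    by_contra h
    rw [integral_undef h] at hμ
    exact hc.ne hμ
  have h := ProbabilityTheory.measure_le_le_exp_mul_mgf (μ := μ) (X := fun s => s) (t := -1) T
    (by norm_num) hint
  rw [ProbabilityTheory.mgf, hμ, neg_neg, one_mul] at h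
  rw [← ofReal_measureReal]
  exact ENNReal.ofReal_le_ofReal ((measureReal_mono fun s hs => hs.2).trans h)

theorem integrable_indicator_density {μr : ℝ → Measure ℝ} {pbar : ℝ → ℝ → ℝ} {c T : ℝ}
    (hc : 0 < c) (hprob : ∀ r : ℝ, 0 < r → IsProbabilityMeasure (μr r))
    (hlap : ∀ r : ℝ, 0 < r → ∫ s, Real.exp (-1 * s) ∂(μr r) = Real.exp (-r * c))
    (hpbar_nn : ∀ r t : ℝ, 0 ≤ pbar r t)
    (hpbar_meas : Measurable (Function.uncurry pbar))
    (hdens : ∀ r : ℝ, 0 < r → ∀ A : Set ℝ, MeasurableSet A →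
      μr r A = ∫⁻ t in A ∩ Ici 0, ENNReal.ofReal (pbar r t)) :
    Integrable ((Ioc 0 T ×ˢ Ioi 0).indicator fun z : ℝ × ℝ => pbar z.2 z.1) := by
  have hmeas : Measurable fun z : ℝ × ℝ => pbar z.2 z.1 := hpbar_meas.comp measurable_swap
  rw [integrable_indicator_iff (measurableSet_Ioc.prod measurableSet_Ioi)]
  refine ⟨hmeas.aestronglyMeasurable, ?_⟩
  rw [hasFiniteIntegral_iff_ofReal (ae_of_all _ fun z => hpbar_nn _ _), Measure.volume_eq_prod,
    ← Measure.prod_restrict, lintegral_prod_symm _ hmeas.ennreal_ofReal.aemeasurable]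
  have hexp : IntegrableOn (fun r : ℝ => Real.exp T * Real.exp (-r * c)) (Ioi 0) := by
    refine Integrable.const_mul ?_ _
    have h := integrableOn_exp_mul_Ioi (neg_neg_iff_pos.2 hc) 0
    simp only [IntegrableOn, neg_mul] at h ⊢
    simpa only [mul_comm] using h
  refine lt_of_le_of_lt (setLIntegral_mono' measurableSet_Ioi fun r hr => ?_)
    ((hasFiniteIntegral_iff_ofReal (ae_of_all _ fun r => by positivity)).1 hexp.2)
  have := hprob r hr
  have h := measure_Ioc_le_of_laplace (Real.exp_pos _) (hlap r hr) T
  rwa [hdens r hr _ measurableSet_Ioc,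
    inter_eq_left.2 (show Ioc 0 T ⊆ Ici 0 from fun x hx => hx.1.le)] at h

end Kernel

section Semigroup

variable {E : Type*} [NormedAddCommGroup E] [NormedSpace ℝ E]

theorem continuous_uncurry_max_zero {P : ℝ → E →L[ℝ] E} {M : ℝ}
    (hM : ∀ t : ℝ, 0 ≤ t → ‖P t‖ ≤ M)
    (hPcont : ∀ g : E, ContinuousOn (fun t => P t g) (Ici (0:ℝ))) :
    Continuous fun p : ℝ × E => P (max p.1 0) p.2 := by
  refine continuous_prod_of_continuous_lipschitzWith' _ M.toNNReal (fun a => ?_) fun b => ?_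
  · exact (P (max a 0)).lipschitz.weaken (by
      rw [← norm_toNNReal]
      exact Real.toNNReal_le_toNNReal (hM _ (le_max_right _ _)))
  · exact (hPcont b).comp_continuous (f := fun r : ℝ => max r 0) (by fun_prop)
      fun r => le_max_right r 0

theorem tendsto_generator_apply {P : ℝ → E →L[ℝ] E}
    (hPsemi : ∀ s t : ℝ, 0 ≤ s → 0 ≤ t → P (s + t) = (P s).comp (P t))
    {x y : E} (hx : Tendsto (fun h : ℝ => h⁻¹ • (P h x - x)) (𝓝[>] 0) (𝓝 y))
    {r : ℝ} (hr : 0 ≤ r) :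
    Tendsto (fun h : ℝ => h⁻¹ • (P h (P r x) - P r x)) (𝓝[>] 0) (𝓝 (P r y)) := by
  refine Tendsto.congr' ?_ (((P r).continuous.tendsto y).comp hx)
  filter_upwards [self_mem_nhdsWithin] with h hh
  have h1 : P h (P r x) = P r (P h x) := by
    rw [← ContinuousLinearMap.comp_apply, ← hPsemi h r (le_of_lt hh) hr, add_comm,
      hPsemi r h hr (le_of_lt hh), ContinuousLinearMap.comp_apply]
  simp [h1]

theorem norm_semigroup_sub_le {P : ℝ → E →L[ℝ] E}
    (hP0 : P 0 = ContinuousLinearMap.id ℝ E)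
    (hPsemi : ∀ s t : ℝ, 0 ≤ s → 0 ≤ t → P (s + t) = (P s).comp (P t))
    {M : ℝ} (hM : ∀ t : ℝ, 0 ≤ t → ‖P t‖ ≤ M)
    (hPcont : ∀ g : E, ContinuousOn (fun t => P t g) (Ici (0:ℝ)))
    {x y : E} (hx : Tendsto (fun h : ℝ => h⁻¹ • (P h x - x)) (𝓝[>] 0) (𝓝 y))
    {h : ℝ} (hh : 0 ≤ h) : ‖P h x - x‖ ≤ M * ‖y‖ * h := by
  have key := norm_image_sub_le_of_norm_deriv_right_le_segment (f := fun t => P t x)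
    (f' := fun t => P t y) (a := 0) (b := h) (C := M * ‖y‖)
    ((hPcont x).mono Icc_subset_Ici_self) (fun a ha => ?_)
    (fun a ha => (P a).le_of_opNorm_le (hM a ha.1) y) h ⟨hh, le_rfl⟩
  · simpa [hP0] using key
  · rw [← hasDerivWithinAt_Ioi_iff_Ici, hasDerivWithinAt_iff_tendsto_slope' self_notMem_Ioi]
    have hsub : Tendsto (fun t => t - a) (𝓝[>] a) (𝓝[>] 0) := by
      refine tendsto_nhdsWithin_iff.2 ⟨?_, ?_⟩
      · have : Tendsto (fun t => t - a) (𝓝 a) (𝓝 (a - a)) := by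
          exact (continuous_id.sub continuous_const).tendsto a
        rw [sub_self] at this
        exact this.mono_left nhdsWithin_le_nhds
      · filter_upwards [self_mem_nhdsWithin] with t ht using (sub_pos.2 (mem_Ioi.1 ht) : 0 < t - a)
    refine Tendsto.congr' ?_ ((tendsto_generator_apply hPsemi hx ha.1).comp hsub)
    filter_upwards [self_mem_nhdsWithin] with t ht
    have : P t x = P (t - a) (P a x) := by
      rw [← ContinuousLinearMap.comp_apply,
        ← hPsemi _ _ (sub_nonneg.2 (le_of_lt (mem_Ioi.1 ht))) ha.1, sub_add_cancel]
    simp [slope, this]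

/-- The generator of a bounded semigroup commutes with Bochner integrals. -/
theorem tendsto_generator_integral [CompleteSpace E] {P : ℝ → E →L[ℝ] E}
    (hP0 : P 0 = ContinuousLinearMap.id ℝ E)
    (hPsemi : ∀ s t : ℝ, 0 ≤ s → 0 ≤ t → P (s + t) = (P s).comp (P t))
    {M : ℝ} (hM : ∀ t : ℝ, 0 ≤ t → ‖P t‖ ≤ M)
    (hPcont : ∀ g : E, ContinuousOn (fun t => P t g) (Ici (0:ℝ)))
    {α : Type*} [MeasurableSpace α] {μ : Measure α} {F LF : α → E}
    (hF : Integrable F μ) (hLF : Integrable LF μ)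
    (hgen : ∀ᵐ z ∂μ, Tendsto (fun h : ℝ => h⁻¹ • (P h (F z) - F z)) (𝓝[>] 0) (𝓝 (LF z))) :
    Tendsto (fun h : ℝ => h⁻¹ • (P h (∫ z, F z ∂μ) - ∫ z, F z ∂μ)) (𝓝[>] 0)
      (𝓝 (∫ z, LF z ∂μ)) := by
  have heq : ∀ h : ℝ, h⁻¹ • (P h (∫ z, F z ∂μ) - ∫ z, F z ∂μ) =
      ∫ z, h⁻¹ • (P h (F z) - F z) ∂μ := fun h => by
    rw [integral_smul, integral_sub ((P h).integrable_comp hF) hF,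
      (P h).integral_comp_comm hF]
  simp_rw [heq]
  refine tendsto_integral_filter_of_dominated_convergence (fun z => M * ‖LF z‖)
    (Eventually.of_forall fun h =>
      ((((P h).integrable_comp hF).sub hF).smul h⁻¹).aestronglyMeasurable) ?_
    (hLF.norm.const_mul M) hgen
  filter_upwards [self_mem_nhdsWithin] with h hh
  filter_upwards [hgen] with z hz
  have hh' : 0 < h := hh
  rw [norm_smul, norm_inv, Real.norm_of_nonneg hh'.le, inv_mul_le_iff₀ hh', mul_comm h]
  exact norm_semigroup_sub_le hP0 hPsemi hM hPcont hz hh'.le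

end Semigroup

section KernelConvolution

variable {E : Type*} [NormedAddCommGroup E] [NormedSpace ℝ E]

theorem integrable_kernel_sub_smul {k : ℝ × ℝ → ℝ} (hk : Integrable k) (hkm : Measurable k)
    {F : ℝ → E} (hF : Integrable F) :
    Integrable fun p : ℝ × (ℝ × ℝ) => k (p.1 - p.2.1, p.2.2) • F p.2.1 := by
  have hmeas : AEStronglyMeasurable
      (fun p : ℝ × (ℝ × ℝ) => k (p.1 - p.2.1, p.2.2) • F p.2.1)
      ((volume : Measure ℝ).prod volume) := by
    refine (hkm.comp (by fun_prop)).aestronglyMeasurable.smul ?_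
    exact (hF.aestronglyMeasurable.comp_fst (ν := (volume : Measure ℝ))).comp_snd
  rw [Measure.volume_eq_prod, integrable_prod_iff' hmeas]
  rw [Measure.volume_eq_prod] at hk
  constructor
  · have := (Measure.quasiMeasurePreserving_snd (μ := (volume : Measure ℝ))
      (ν := (volume : Measure ℝ))).ae hk.prod_left_ae
    filter_upwards [this] with z hz
    exact (hz.comp_sub_right z.1).smul_const _
  · have h : Integrable (fun z : ℝ × ℝ => ‖F z.1‖ * ∫ τ, ‖k (τ, z.2)‖) :=
      hF.norm.mul_prod hk.norm.integral_prod_right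
    refine h.congr (ae_of_all _ fun z => ?_)
    simp only [norm_smul]
    rw [integral_mul_const, integral_sub_right_eq_self (fun τ => ‖k (τ, z.2)‖), mul_comm]

theorem integrable_kernel_sub_smul_apply {k : ℝ × ℝ → ℝ} (hk : Integrable k)
    (hkm : Measurable k) {Q : ℝ → E →L[ℝ] E} {M : ℝ} (hM : ∀ r, ‖Q r‖ ≤ M)
    (hQ : Continuous fun p : ℝ × E => Q p.1 p.2) {F : ℝ → E} (hF : Integrable F) :
    Integrable fun p : ℝ × (ℝ × ℝ) => k (p.1 - p.2.1, p.2.2) • Q p.2.2 (F p.2.1) := by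
  refine Integrable.mono' ((integrable_kernel_sub_smul hk hkm hF).norm.const_mul M) ?_
    (ae_of_all _ fun p => ?_)
  · refine (hkm.comp (by fun_prop)).aestronglyMeasurable.smul ?_
    refine hQ.comp_aestronglyMeasurable (AEStronglyMeasurable.prodMk (by fun_prop) ?_)
    exact (hF.aestronglyMeasurable.comp_fst (ν := (volume : Measure ℝ))).comp_snd
  · rw [norm_smul, norm_smul, mul_left_comm]
    gcongr
    exact (Q p.2.2).le_of_opNorm_le (hM _) _

theorem aestronglyMeasurable_apply_fst {Q : ℝ → E →L[ℝ] E}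
    (hQ : Continuous fun p : ℝ × E => Q p.1 p.2) {F : ℝ → E} (hF : AEStronglyMeasurable F) :
    AEStronglyMeasurable fun z : ℝ × ℝ => Q z.2 (F z.1) :=
  hQ.comp_aestronglyMeasurable
    (AEStronglyMeasurable.prodMk (by fun_prop) (hF.comp_fst (ν := (volume : Measure ℝ))))

theorem ae_norm_apply_fst_le {Q : ℝ → E →L[ℝ] E} {M : ℝ} (hM : ∀ r, ‖Q r‖ ≤ M) {F : ℝ → E}
    {K : ℝ} (hK : ∀ᵐ s, ‖F s‖ ≤ K) : ∀ᵐ z : ℝ × ℝ, ‖Q z.2 (F z.1)‖ ≤ M * K := by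
  have := (Measure.quasiMeasurePreserving_fst (μ := (volume : Measure ℝ))
      (ν := (volume : Measure ℝ))).ae hK
  filter_upwards [this] with z hz
  exact (Q z.2).le_of_opNorm_le_of_le (hM _) hz

theorem integrable_kernel_sub_reflect {k : ℝ × ℝ → ℝ} (hk : Integrable k) (t : ℝ) :
    Integrable fun z : ℝ × ℝ => k (t - z.1, z.2) :=
  ((Measure.measurePreserving_sub_left volume t).prod
    (MeasurePreserving.id volume)).integrable_comp_of_integrable hk

theorem continuous_integral_kernel_sub_smul {k : ℝ × ℝ → ℝ} (hk : Integrable k)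
    {G : ℝ × ℝ → E} (hG : AEStronglyMeasurable G) {C : ℝ} (hC : ∀ᵐ z, ‖G z‖ ≤ C) :
    Continuous fun t : ℝ => ∫ z : ℝ × ℝ, k (t - z.1, z.2) • G z := by
  have hk' : Integrable fun z : ℝ × ℝ => k (z.1, -z.2) :=
    ((MeasurePreserving.id volume).prod
      (Measure.measurePreserving_neg volume)).integrable_comp_of_integrable hk
  have h := (continuous_integral_smul_of_integrable_of_bounded hk' hG hC).comp
    (show Continuous fun t : ℝ => (t, (0 : ℝ)) by fun_prop)
  simpa [Function.comp_def] using h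

end KernelConvolution

theorem ae_norm_indicator_le {α E : Type*} [MeasurableSpace α] [NormedAddCommGroup E]
    {μ : Measure α} {S : Set α} (hS : MeasurableSet S) {g : α → E} {K : ℝ}
    (hK : ∀ᵐ s ∂μ.restrict S, ‖g s‖ ≤ K) : ∀ᵐ s ∂μ, ‖S.indicator g s‖ ≤ |K| := by
  filter_upwards [(ae_restrict_iff' hS).1 hK] with s hs
  by_cases h : s ∈ S
  · simpa [h] using (hs h).trans (le_abs_self K)
  · simp [h]

/-- Proposition 2.3(iii).  If `f(t) ∈ 𝒟(𝓛)` for a.e. `t ∈ (0,T₀]` with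
`∫₀^{T₀}(‖f‖+‖𝓛f‖) dt < ∞`, then `u(t) = ∫₀^t∫₀^∞ P⁰_r f(s) p̄(r,t−s) dr ds` satisfies
`u(t) ∈ 𝒟(𝓛)` for a.e. `t` and `∫₀^{T₀} ‖𝓛u(t)‖ dt < ∞`; if moreover
`‖f(s)‖+‖𝓛f(s)‖ ≤ K` a.e., then `t ↦ 𝓛u(t)` is continuous on `(0,T₀]`.
Here `g ∈ 𝒟(𝓛)` with `𝓛g = L` means `(P⁰_h g − g)/h → L` as `h ↓ 0`. -/
theorem time_frac_stmt3
    {𝔹 : Type*} [NormedAddCommGroup 𝔹] [NormedSpace ℝ 𝔹] [CompleteSpace 𝔹]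
    (ν : Measure ℝ)
    (hν_loc : ∫⁻ x in Set.Ioi (0:ℝ), ENNReal.ofReal (min 1 x) ∂ν ≠ ⊤)
    (hν_inf : ν (Set.Ioi (0:ℝ)) = ⊤)
    (φ : ℝ → ℝ)
    (hφ : ∀ l : ℝ, 0 < l → φ l = ∫ x in Set.Ioi (0:ℝ), (1 - Real.exp (-l * x)) ∂ν)
    (w : ℝ → ℝ)
    (hw : ∀ x : ℝ, w x = (ν (Set.Ioi x)).toReal)
    (μr : ℝ → Measure ℝ)
    (hprob : ∀ r : ℝ, 0 < r → IsProbabilityMeasure (μr r))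
    (hlap : ∀ r : ℝ, 0 < r → ∀ l : ℝ, 0 < l →
      ∫ s, Real.exp (-l * s) ∂(μr r) = Real.exp (-r * φ l))
    (pbar : ℝ → ℝ → ℝ)
    (hpbar_nn : ∀ r t : ℝ, 0 ≤ pbar r t)
    (hpbar_meas : Measurable (Function.uncurry pbar))
    (hpbar_bdd : ∀ r : ℝ, 0 < r → ∃ C : ℝ, ∀ t : ℝ, pbar r t ≤ C)
    (hdens : ∀ r : ℝ, 0 < r → ∀ A : Set ℝ, MeasurableSet A →
      μr r A = ∫⁻ t in A ∩ Set.Ici 0, ENNReal.ofReal (pbar r t))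
    -- uniformly bounded strongly continuous semigroup on 𝔹
    (P : ℝ → 𝔹 →L[ℝ] 𝔹)
    (hP0 : P 0 = ContinuousLinearMap.id ℝ 𝔹)
    (hPsemi : ∀ s t : ℝ, 0 ≤ s → 0 ≤ t → P (s + t) = (P s).comp (P t))
    (M : ℝ) (hM : ∀ t : ℝ, 0 ≤ t → ‖P t‖ ≤ M)
    (hPcont : ∀ g : 𝔹, ContinuousOn (fun t => P t g) (Set.Ici (0:ℝ)))
    -- the data: f takes values in 𝒟(𝓛) a.e., with generator value Lf
    (T₀ : ℝ) (hT₀ : 0 < T₀)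
    (f Lf : ℝ → 𝔹)
    (hf_dom : ∀ᵐ t ∂(volume.restrict (Set.Ioc (0:ℝ) T₀)),
      Tendsto (fun h : ℝ => h⁻¹ • (P h (f t) - f t)) (nhdsWithin 0 (Set.Ioi (0:ℝ)))
        (nhds (Lf t)))
    (hf_int : IntegrableOn f (Set.Ioc 0 T₀))
    (hLf_int : IntegrableOn Lf (Set.Ioc 0 T₀))
    (u : ℝ → 𝔹)
    (hu : ∀ t : ℝ, u t =
      ∫ s in Set.Ioc (0:ℝ) t, ∫ r in Set.Ioi (0:ℝ), pbar r (t - s) • P r (f s)) :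
    (∃ Lu : ℝ → 𝔹,
      (∀ᵐ t ∂(volume.restrict (Set.Ioc (0:ℝ) T₀)),
        Tendsto (fun h : ℝ => h⁻¹ • (P h (u t) - u t)) (nhdsWithin 0 (Set.Ioi (0:ℝ)))
          (nhds (Lu t))) ∧
      IntegrableOn Lu (Set.Ioc 0 T₀)) ∧
    (∀ K : ℝ,
      (∀ᵐ s ∂(volume.restrict (Set.Ioc (0:ℝ) T₀)), ‖f s‖ + ‖Lf s‖ ≤ K) →
      ∃ Lu : ℝ → 𝔹,
        (∀ t ∈ Set.Ioc (0:ℝ) T₀,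
          Tendsto (fun h : ℝ => h⁻¹ • (P h (u t) - u t)) (nhdsWithin 0 (Set.Ioi (0:ℝ)))
            (nhds (Lu t))) ∧
        ContinuousOn Lu (Set.Ioc (0:ℝ) T₀)) := by
  have hc : 0 < φ 1 := by
    rw [hφ 1 one_pos]
    exact laplaceExponent_one_pos hν_loc (by rw [hν_inf]; exact ENNReal.top_ne_zero)
  set k : ℝ × ℝ → ℝ := (Ioc 0 T₀ ×ˢ Ioi 0).indicator fun z : ℝ × ℝ => pbar z.2 z.1 with hkdef
  have hk : Integrable k := integrable_indicator_density hc hprob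
    (fun r hr => hlap r hr 1 one_pos) hpbar_nn hpbar_meas hdens
  have hkm : Measurable k := (hpbar_meas.comp measurable_swap).indicator
    (measurableSet_Ioc.prod measurableSet_Ioi)
  set Q : ℝ → 𝔹 →L[ℝ] 𝔹 := fun r => P (max r 0) with hQdef
  have hQM : ∀ r, ‖Q r‖ ≤ M := fun r => hM _ (le_max_right _ _)
  have hQ : Continuous fun p : ℝ × 𝔹 => Q p.1 p.2 := continuous_uncurry_max_zero hM hPcont
  set F : ℝ → 𝔹 := (Ioc 0 T₀).indicator f with hFdef
  set LF : ℝ → 𝔹 := (Ioc 0 T₀).indicator Lf with hLFdef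
  have hF : Integrable F := hf_int.integrable_indicator measurableSet_Ioc
  have hLF : Integrable LF := hLf_int.integrable_indicator measurableSet_Ioc
  have hgenF : ∀ᵐ s, Tendsto (fun h : ℝ => h⁻¹ • (P h (F s) - F s)) (𝓝[>] 0) (𝓝 (LF s)) := by
    filter_upwards [(ae_restrict_iff' measurableSet_Ioc).1 hf_dom] with s hs
    by_cases h : s ∈ Ioc 0 T₀
    · simpa [hFdef, hLFdef, h] using hs h
    · simp [hFdef, hLFdef, h]
  have hgen : ∀ t : ℝ, ∀ᵐ z : ℝ × ℝ, Tendsto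
      (fun h : ℝ => h⁻¹ • (P h (k (t - z.1, z.2) • Q z.2 (F z.1)) -
        k (t - z.1, z.2) • Q z.2 (F z.1))) (𝓝[>] 0)
      (𝓝 (k (t - z.1, z.2) • Q z.2 (LF z.1))) := fun t => by
    filter_upwards [(Measure.quasiMeasurePreserving_fst (μ := (volume : Measure ℝ))
      (ν := (volume : Measure ℝ))).ae hgenF] with z hz
    refine ((tendsto_generator_apply hPsemi hz (le_max_right z.2 0)).const_smul
      (k (t - z.1, z.2))).congr fun h => ?_
    rw [map_smul, ← smul_sub, smul_comm]
  have hu_eq : ∀ t ∈ Ioc 0 T₀,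
      Integrable (fun z : ℝ × ℝ => k (t - z.1, z.2) • Q z.2 (F z.1)) →
      u t = ∫ z : ℝ × ℝ, k (t - z.1, z.2) • Q z.2 (F z.1) := fun t ht hint => by
    rw [Measure.volume_eq_prod] at hint
    rw [hu, Measure.volume_eq_prod, integral_prod _ hint, ← integral_indicator measurableSet_Ioc]
    refine integral_congr_ae ?_
    filter_upwards [Measure.ae_ne volume t] with s hst
    by_cases hs : s ∈ Ioc 0 t
    · have hs' : s ∈ Ioc 0 T₀ := ⟨hs.1, hs.2.trans ht.2⟩
      have hts : t - s ∈ Ioc 0 T₀ :=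
        ⟨sub_pos.2 (lt_of_le_of_ne hs.2 hst), by linarith [hs.1, ht.2]⟩
      rw [indicator_of_mem hs, ← integral_indicator measurableSet_Ioi]
      congr 1
      ext r
      by_cases hr : r ∈ Ioi (0 : ℝ)
      · have hmem : (t - s, r) ∈ Ioc 0 T₀ ×ˢ Ioi (0 : ℝ) := ⟨hts, hr⟩
        have hmax : max r 0 = r := max_eq_left (le_of_lt hr)
        rw [indicator_of_mem hr]
        simp only [hkdef, hQdef, hFdef, indicator_of_mem hmem, indicator_of_mem hs', hmax]
      · have hmem : (t - s, r) ∉ Ioc 0 T₀ ×ˢ Ioi (0 : ℝ) := fun h => hr h.2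
        rw [indicator_of_notMem hr]
        simp only [hkdef, indicator_of_notMem hmem, zero_smul]
    · rw [indicator_of_notMem hs]
      symm
      refine integral_eq_zero_of_ae (ae_of_all _ fun r => ?_)
      by_cases hs' : s ∈ Ioc 0 T₀
      · have hmem : (t - s, r) ∉ Ioc 0 T₀ ×ˢ Ioi (0 : ℝ) := fun h =>
          hs ⟨hs'.1, (sub_pos.1 h.1.1).le⟩
        simp only [hkdef, indicator_of_notMem hmem, zero_smul, Pi.zero_apply]
      · simp only [hFdef, indicator_of_notMem hs', map_zero, smul_zero, Pi.zero_apply]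
  have hgen_u : ∀ t ∈ Ioc 0 T₀,
      Integrable (fun z : ℝ × ℝ => k (t - z.1, z.2) • Q z.2 (F z.1)) →
      Integrable (fun z : ℝ × ℝ => k (t - z.1, z.2) • Q z.2 (LF z.1)) →
      Tendsto (fun h : ℝ => h⁻¹ • (P h (u t) - u t)) (𝓝[>] 0)
        (𝓝 (∫ z : ℝ × ℝ, k (t - z.1, z.2) • Q z.2 (LF z.1))) := fun t ht h1 h2 => by
    rw [hu_eq t ht h1]
    exact tendsto_generator_integral hP0 hPsemi hM hPcont h1 h2 (hgen t)
  have hbF : ∀ K : ℝ, (∀ᵐ s ∂(volume.restrict (Ioc (0:ℝ) T₀)), ‖f s‖ + ‖Lf s‖ ≤ K) →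
      ∀ᵐ s, ‖F s‖ ≤ |K| := fun K hK => ae_norm_indicator_le measurableSet_Ioc <|
    hK.mono fun s hs => (le_add_of_nonneg_right (norm_nonneg _)).trans hs
  have hbLF : ∀ K : ℝ, (∀ᵐ s ∂(volume.restrict (Ioc (0:ℝ) T₀)), ‖f s‖ + ‖Lf s‖ ≤ K) →
      ∀ᵐ s, ‖LF s‖ ≤ |K| := fun K hK => ae_norm_indicator_le measurableSet_Ioc <|
    hK.mono fun s hs => (le_add_of_nonneg_left (norm_nonneg _)).trans hs
  refine ⟨⟨fun t => ∫ z : ℝ × ℝ, k (t - z.1, z.2) • Q z.2 (LF z.1), ?_, ?_⟩, fun K hK =>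
    ⟨fun t => ∫ z : ℝ × ℝ, k (t - z.1, z.2) • Q z.2 (LF z.1), fun t ht => ?_, ?_⟩⟩
  · refine (ae_restrict_iff' measurableSet_Ioc).2 ?_
    filter_upwards [(integrable_kernel_sub_smul_apply hk hkm hQM hQ hF).prod_right_ae,
      (integrable_kernel_sub_smul_apply hk hkm hQM hQ hLF).prod_right_ae] with t h1 h2 ht
    exact hgen_u t ht h1 h2
  · exact (integrable_kernel_sub_smul_apply hk hkm hQM hQ hLF).integral_prod_left.integrableOn
  · refine hgen_u t ht ?_ ?_
    · exact (integrable_kernel_sub_reflect hk t).smul_bdd (M * |K|)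
        (aestronglyMeasurable_apply_fst hQ hF.aestronglyMeasurable)
        (ae_norm_apply_fst_le hQM (hbF K hK))
    · exact (integrable_kernel_sub_reflect hk t).smul_bdd (M * |K|)
        (aestronglyMeasurable_apply_fst hQ hLF.aestronglyMeasurable)
        (ae_norm_apply_fst_le hQM (hbLF K hK))
  · exact (continuous_integral_kernel_sub_smul hk
      (aestronglyMeasurable_apply_fst hQ hLF.aestronglyMeasurable)
      (ae_norm_apply_fst_le hQM (hbLF K hK))).continuousOn
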